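/- Let μ be a finite positive Borel measure on [0,∞) with μ([0,∞)) = 1, let g(z) = ∫₀^∞ e^{−zs} dμ(s) (so g is bounded completely monotone with g(0) = 1), and suppose ∫₀^∞ g(t)ᵏ dt < ∞ for some positive integer k. Then there exists a constant C(g) > 0 such that for every β ∈ [0,1] and every integer n ≥ 2k + 1: ∫₀^∞ g(z)ⁿ z^β dz ≤ C(g) n^{−1−β}. -/

import Mathlib

open MeasureTheory Real Set Filter

section LaplaceTransform

variable {μ : Measure ℝ}

lemma ae_nonneg_of_measure_Iio_zero (hsupp : μ (Set.Iio 0) = 0) : ∀ᵐ s ∂μ, 0 ≤ s := by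
  rw [ae_iff]
  simp only [not_le]
  exact hsupp

variable [IsProbabilityMeasure μ]

lemma integrable_exp_neg_mul (hsupp : μ (Set.Iio 0) = 0) {z : ℝ} (hz : 0 ≤ z) :
    Integrable (fun s => Real.exp (-z * s)) μ := by
  refine (integrable_const (1 : ℝ)).mono' (by fun_prop) ?_
  filter_upwards [ae_nonneg_of_measure_Iio_zero hsupp] with s hs
  rw [norm_of_nonneg (exp_pos _).le, exp_le_one_iff]
  nlinarith [mul_nonneg hz hs]

lemma laplace_pos (hsupp : μ (Set.Iio 0) = 0) {z : ℝ} (hz : 0 ≤ z) :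
    0 < ∫ s, Real.exp (-z * s) ∂μ :=
  integral_exp_pos (integrable_exp_neg_mul hsupp hz)

lemma laplace_anti (hsupp : μ (Set.Iio 0) = 0) {y z : ℝ} (hy : 0 ≤ y) (hyz : y ≤ z) :
    ∫ s, Real.exp (-z * s) ∂μ ≤ ∫ s, Real.exp (-y * s) ∂μ := by
  refine integral_mono_ae (integrable_exp_neg_mul hsupp (hy.trans hyz))
    (integrable_exp_neg_mul hsupp hy) ?_
  filter_upwards [ae_nonneg_of_measure_Iio_zero hsupp] with s hs
  exact exp_le_exp.2 (by nlinarith)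

lemma laplace_le_chord (hsupp : μ (Set.Iio 0) = 0) {A θ : ℝ} (hA : 0 ≤ A) (h0 : 0 ≤ θ)
    (h1 : θ ≤ 1) :
    ∫ s, Real.exp (-(θ * A) * s) ∂μ ≤ (1 - θ) + θ * ∫ s, Real.exp (-A * s) ∂μ := by
  have hi := integrable_exp_neg_mul hsupp hA
  have hsum : ∫ s, ((1 - θ) + θ * Real.exp (-A * s)) ∂μ
      = (1 - θ) + θ * ∫ s, Real.exp (-A * s) ∂μ := by
    rw [integral_add (integrable_const _) (hi.const_mul θ), integral_const_mul]
    simp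
  rw [← hsum]
  refine integral_mono (integrable_exp_neg_mul hsupp (mul_nonneg h0 hA))
    ((integrable_const _).add (hi.const_mul θ)) fun s => ?_
  have h := convexOn_exp.2 (mem_univ (0 : ℝ)) (mem_univ (-A * s)) (sub_nonneg.2 h1) h0
    (by ring)
  simp only [smul_eq_mul, mul_zero, zero_add, exp_zero, mul_one] at h
  calc Real.exp (-(θ * A) * s) = Real.exp (θ * (-A * s)) := by ring_nf
    _ ≤ _ := h

end LaplaceTransform

lemma mul_le_setIntegral_Ioi_of_antitone {f : ℝ → ℝ} (hf : IntegrableOn f (Set.Ioi 0))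
    (hpos : ∀ t, 0 ≤ t → 0 ≤ f t) (hanti : ∀ s t, 0 ≤ s → s ≤ t → f t ≤ f s) {t : ℝ}
    (ht : 0 ≤ t) : t * f t ≤ ∫ s in Set.Ioi 0, f s := by
  calc t * f t = ∫ _ in Set.Ioc 0 t, f t := by simp [ht]
    _ ≤ ∫ s in Set.Ioc 0 t, f s :=
        setIntegral_mono_on (integrable_const _) (hf.mono_set Ioc_subset_Ioi_self)
          measurableSet_Ioc fun s hs => hanti s t hs.1.le hs.2
    _ ≤ ∫ s in Set.Ioi 0, f s := by
        refine setIntegral_mono_set hf ?_ Ioc_subset_Ioi_self.eventuallyLE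
        filter_upwards [ae_restrict_mem measurableSet_Ioi] with s hs
        exact hpos s (le_of_lt hs)

lemma Gamma_le_one_of_mem_Icc {a : ℝ} (h1 : 1 ≤ a) (h2 : a ≤ 2) : Real.Gamma a ≤ 1 := by
  have h := convexOn_Gamma.2 (mem_Ioi.2 one_pos) (mem_Ioi.2 two_pos)
    (sub_nonneg.2 h2) (sub_nonneg.2 h1) (by ring)
  simp only [smul_eq_mul, Gamma_one, Gamma_two] at h
  calc Real.Gamma a = Real.Gamma ((2 - a) * 1 + (a - 1) * 2) := by ring_nf
    _ ≤ _ := h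
    _ = 1 := by ring

lemma rpow_le_one_add {z β : ℝ} (hz : 0 ≤ z) (h0 : 0 ≤ β) (h1 : β ≤ 1) : z ^ β ≤ 1 + z := by
  calc z ^ β ≤ (1 + z) ^ β := rpow_le_rpow hz (by linarith) h0
    _ ≤ (1 + z) ^ (1 : ℝ) := rpow_le_rpow_of_exponent_le (by linarith) h1
    _ = 1 + z := rpow_one _

lemma integrableOn_rpow_mul_exp_neg_mul {β r : ℝ} (hβ : 0 ≤ β) (hr : 0 < r) :
    IntegrableOn (fun z => z ^ β * Real.exp (-(r * z))) (Set.Ioi 0) := by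
  simpa only [rpow_one, neg_mul] using
    integrableOn_rpow_mul_exp_neg_mul_rpow (s := β) (p := 1) (by linarith) one_pos hr

lemma integral_rpow_mul_exp_neg_mul_le {β c x : ℝ} (h0 : 0 ≤ β) (h1 : β ≤ 1) (hc : 0 < c)
    (hx : 0 < x) :
    ∫ z in Set.Ioi 0, z ^ β * Real.exp (-(c * x * z)) ≤ (1 + 1 / c) ^ 2 * x ^ (-1 - β) := by
  have h := integral_rpow_mul_exp_neg_mul_Ioi (a := 1 + β) (by linarith) (mul_pos hc hx)
  rw [add_sub_cancel_left] at h
  have hc' : 0 < 1 / c := by positivity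
  have hsplit : (1 / (c * x)) ^ (1 + β) = (1 / c) ^ (1 + β) * x ^ (-1 - β) := by
    rw [one_div, mul_inv, ← one_div, mul_rpow hc'.le (by positivity), inv_rpow hx.le,
      ← rpow_neg hx.le, neg_add']
  have hpow : (1 / c) ^ (1 + β) ≤ (1 + 1 / c) ^ 2 := by
    calc (1 / c) ^ (1 + β) ≤ (1 + 1 / c) ^ (1 + β) :=
          rpow_le_rpow hc'.le (by linarith) (by linarith)
      _ ≤ (1 + 1 / c) ^ (2 : ℝ) := rpow_le_rpow_of_exponent_le (by linarith) (by linarith)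
      _ = _ := rpow_two _
  rw [h, hsplit]
  calc (1 / c) ^ (1 + β) * x ^ (-1 - β) * Real.Gamma (1 + β)
      ≤ (1 / c) ^ (1 + β) * x ^ (-1 - β) * 1 := by
        gcongr
        exact Gamma_le_one_of_mem_Icc (by linarith) (by linarith)
    _ ≤ _ := by rw [mul_one]; gcongr

lemma exists_sq_mul_pow_le {q : ℝ} (h0 : 0 ≤ q) (h1 : q < 1) :
    ∃ B > (0 : ℝ), ∀ n : ℕ, (n : ℝ) ^ 2 * q ^ n ≤ B := by
  obtain ⟨B, hB⟩ := (tendsto_pow_const_mul_const_pow_of_abs_lt_one 2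
    (abs_lt.2 ⟨by linarith, h1⟩)).bddAbove_range
  exact ⟨max B 1, by positivity, fun n => (hB ⟨n, rfl⟩).trans (le_max_left _ _)⟩

lemma inv_sq_le_rpow {x β : ℝ} (hx : 1 ≤ x) (h1 : β ≤ 1) : (x ^ 2)⁻¹ ≤ x ^ (-1 - β) := by
  rw [← rpow_two, ← rpow_neg (by linarith)]
  exact rpow_le_rpow_of_exponent_le hx (by linarith)

theorem stmt_13
    (μ : Measure ℝ) [IsProbabilityMeasure μ]
    (hsupp : μ (Set.Iio 0) = 0)
    (g : ℝ → ℝ) (hg : ∀ z : ℝ, g z = ∫ s, Real.exp (-z * s) ∂μ)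
    (k : ℕ) (hk : 0 < k)
    (hIk : IntegrableOn (fun t => g t ^ k) (Set.Ioi 0)) :
    ∃ C > (0:ℝ), ∀ β ∈ Set.Icc (0:ℝ) 1, ∀ n : ℕ, 2 * k + 1 ≤ n →
      (∫ z in Set.Ioi (0:ℝ), g z ^ n * z ^ β) ≤ C * (n:ℝ) ^ (-1 - β) := by
  have hpos : ∀ z, 0 ≤ z → 0 < g z := fun z hz => hg z ▸ laplace_pos hsupp hz
  have hanti : ∀ y z, 0 ≤ y → y ≤ z → g z ≤ g y := fun y z hy hyz => by
    rw [hg, hg]; exact laplace_anti hsupp hy hyz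
  have hle1 : ∀ z, 0 ≤ z → g z ≤ 1 := fun z hz =>
    (hanti 0 z le_rfl hz).trans_eq (by simp [hg])
  set M := ∫ t in Set.Ioi 0, g t ^ k with hM
  have hM0 : 0 ≤ M :=
    setIntegral_nonneg measurableSet_Ioi fun t ht => pow_nonneg (hpos t (le_of_lt ht)).le _
  have hMt : ∀ t, 0 ≤ t → t * g t ^ k ≤ M := fun t ht =>
    mul_le_setIntegral_Ioi_of_antitone hIk (fun t ht => pow_nonneg (hpos t ht).le _)
      (fun s t hs hst => pow_le_pow_left₀ (hpos t (hs.trans hst)).le (hanti s t hs hst) k) ht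
  set A := M + 1 with hA
  have hA0 : 0 < A := by linarith
  set q := g A with hq
  have hq0 : 0 < q := hpos A hA0.le
  have hq1 : q < 1 := by
    by_contra! h
    nlinarith [hMt A hA0.le, one_le_pow₀ (n := k) h]
  set c := (1 - q) / A with hc
  have hc0 : 0 < c := div_pos (by linarith) hA0
  have hhead : ∀ z, 0 ≤ z → z ≤ A → g z ≤ Real.exp (-(c * z)) := fun z hz hzA => by
    have h := laplace_le_chord hsupp hA0.le (div_nonneg hz hA0.le) ((div_le_one hA0).2 hzA)
    rw [div_mul_cancel₀ _ hA0.ne', ← hg, ← hg] at h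
    calc g z ≤ -(c * z) + 1 := h.trans_eq (by rw [hc, ← hq]; ring)
      _ ≤ _ := add_one_le_exp _
  obtain ⟨B, hB0, hB⟩ := exists_sq_mul_pow_le hq0.le hq1
  refine ⟨(1 + 1 / c) ^ 2 + B / q ^ (2 * k) * (1 + M) * M, by positivity, ?_⟩
  rintro β ⟨hβ0, hβ1⟩ n hn
  have hn1 : (1 : ℝ) ≤ n := by exact_mod_cast (by omega : 1 ≤ n)
  have hcn : 0 < c * n := by positivity
  have hqn : q ^ (n - 2 * k) ≤ B / q ^ (2 * k) * (n : ℝ) ^ (-1 - β) := by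
    calc q ^ (n - 2 * k) = (n : ℝ) ^ 2 * q ^ n / q ^ (2 * k) * ((n : ℝ) ^ 2)⁻¹ := by
          rw [pow_sub₀ _ hq0.ne' (by omega)]
          field_simp
      _ ≤ _ := by
          gcongr
          · exact hB n
          · exact inv_sq_le_rpow hn1 hβ1
  have hpt : ∀ z ∈ Set.Ioi (0 : ℝ), g z ^ n * z ^ β ≤
      z ^ β * Real.exp (-(c * n * z)) + q ^ (n - 2 * k) * (1 + M) * g z ^ k := by
    intro z hz
    have hz0 : 0 ≤ z := le_of_lt hz
    have hgz := hpos z hz0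
    rcases le_total z A with hzA | hAz
    · have h : g z ^ n ≤ Real.exp (-(c * n * z)) := by
        calc g z ^ n ≤ Real.exp (-(c * z)) ^ n := pow_le_pow_left₀ hgz.le (hhead z hz0 hzA) n
          _ = _ := by rw [← Real.exp_nat_mul]; ring_nf
      have h' := mul_le_mul_of_nonneg_right h (rpow_nonneg hz0 β)
      have : 0 ≤ q ^ (n - 2 * k) * (1 + M) * g z ^ k := by positivity
      linarith
    · have h : g z ^ k * z ^ β ≤ 1 + M := by
        calc g z ^ k * z ^ β ≤ g z ^ k * (1 + z) := by
              gcongr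
              exact rpow_le_one_add hz0 hβ0 hβ1
          _ ≤ _ := by linarith [hMt z hz0, pow_le_one₀ (n := k) hgz.le (hle1 z hz0)]
      calc g z ^ n * z ^ β = g z ^ (n - 2 * k) * (g z ^ k * z ^ β) * g z ^ k := by
            conv_lhs => rw [show n = (n - 2 * k) + k + k by omega, pow_add, pow_add]
            ring
        _ ≤ q ^ (n - 2 * k) * (1 + M) * g z ^ k := by
            gcongr
            exact hanti A z hA0.le hAz
        _ ≤ _ := le_add_of_nonneg_left (by positivity)
  have hi := integrableOn_rpow_mul_exp_neg_mul hβ0 hcn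
  have hj := hIk.const_mul (q ^ (n - 2 * k) * (1 + M))
  calc ∫ z in Set.Ioi (0:ℝ), g z ^ n * z ^ β
      ≤ ∫ z in Set.Ioi (0:ℝ), (z ^ β * Real.exp (-(c * n * z))
          + q ^ (n - 2 * k) * (1 + M) * g z ^ k) := by
        refine integral_mono_of_nonneg ?_ (hi.add hj) ?_
        · filter_upwards [ae_restrict_mem measurableSet_Ioi] with z hz
          exact mul_nonneg (pow_nonneg (hpos z (le_of_lt hz)).le _) (rpow_nonneg (le_of_lt hz) _)
        · filter_upwards [ae_restrict_mem measurableSet_Ioi] with z hz using hpt z hz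
    _ = (∫ z in Set.Ioi (0:ℝ), z ^ β * Real.exp (-(c * n * z)))
          + q ^ (n - 2 * k) * (1 + M) * M := by
        rw [integral_add hi hj, integral_const_mul]
    _ ≤ (1 + 1 / c) ^ 2 * (n : ℝ) ^ (-1 - β)
          + B / q ^ (2 * k) * (n : ℝ) ^ (-1 - β) * (1 + M) * M := by
        gcongr
        exact integral_rpow_mul_exp_neg_mul_le hβ0 hβ1 hc0 (by linarith)
    _ = _ := by ring
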